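/- For r = p prime, S = (s_1,...,s_n) with 0 ≤ s_i ≤ p and n̄ = s_1 + ... + s_n ≥ pk, the chromatic number of KG^p_S(n,k) satisfies χ(KG^p_S(n,k)) ≥ ⌈(n̄ - p(k-1))/(p-1)⌉, as follows by combining the (n̄ - pk - 1)-connectivity of C_s(n,k,...,k) (the maximal nerve of C(KG^p_S(n,k))) with the Alon–Frankl–Lovász connectivity-to-chromatic-number bound. -/

import Mathlib

open Finset

/-- A coloring of the vertices is proper if no edge is monochromatic. -/
def IsProperColoring {V : Type*} (E : Set (Multiset V)) {t : ℕ} (c : V → Fin t) : Prop :=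
  ∀ e ∈ E, ∃ a ∈ e, ∃ b ∈ e, c a ≠ c b

/-- The chromatic number of a hypergraph with edge set `E`, as an extended natural number
(infinity if no proper coloring exists, e.g. in the presence of a loop edge). -/
noncomputable def hypChromatic {V : Type*} (E : Set (Multiset V)) : ℕ∞ :=
  sInf {N : ℕ∞ | ∃ t : ℕ, N = (t : ℕ∞) ∧ ∃ c : V → Fin t, IsProperColoring E c}

/-- Vertices of `KG^r_S(n,k)`: the `k`-subsets of `[n]`. -/
def KGSVertex (n k : ℕ) : Type :=
  {A : Finset (Fin n) // A.card = k}

/-- Edges of `KG^r_S(n,k)`: multisets `{A_1, …, A_r}` of `k`-subsets that are `S`-disjoint,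
i.e. each `i ∈ [n]` belongs to at most `s i` of the sets. -/
def KGSEdges (n k r : ℕ) (s : Fin n → ℕ) : Set (Multiset (KGSVertex n k)) :=
  {e | Multiset.card e = r ∧ ∀ x : Fin n, (e.filter fun A => x ∈ A.1).card ≤ s x}

/-! ### Cochains on lists

An ordered cochain on `V` is a function `List V → F`; a list `[v₀, …, v_d]` is an ordered
`d`-simplex and the empty list is the augmentation simplex. -/

section Cochains

variable {V W F : Type*} [CommRing F]

/-- The coboundary of an (augmented) ordered cochain. -/
def coboundary : (List V → F) → List V → F
  | _, [] => 0
  | f, x :: w => f w - coboundary (fun l => f (x :: l)) w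

@[simp] lemma coboundary_nil (f : List V → F) : coboundary f [] = 0 := by
  simp [coboundary]

lemma coboundary_cons (f : List V → F) (x : V) (w : List V) :
    coboundary f (x :: w) = f w - coboundary (fun l => f (x :: l)) w := by
  simp [coboundary]

lemma coboundary_sub (f g : List V → F) (l : List V) :
    coboundary (fun l => f l - g l) l = coboundary f l - coboundary g l := by
  induction l generalizing f g with
  | nil => simp
  | cons x w ih => simp only [coboundary_cons, ih]; ring

lemma coboundary_zero (l : List V) : coboundary (fun _ => (0 : F)) l = 0 := by
  simpa using coboundary_sub (fun _ => (0 : F)) (fun _ => 0) l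

lemma coboundary_sum {ι : Type*} (s : Finset ι) (f : ι → List V → F) (l : List V) :
    coboundary (fun l => ∑ i ∈ s, f i l) l = ∑ i ∈ s, coboundary (f i) l := by
  induction l generalizing f with
  | nil => simp
  | cons x w ih => simp only [coboundary_cons, ih, Finset.sum_sub_distrib]

lemma coboundary_comp_map (g : V → W) (f : List W → F) (l : List V) :
    coboundary (fun l => f (l.map g)) l = coboundary f (l.map g) := by
  induction l generalizing f with
  | nil => simp
  | cons x w ih =>
    simp only [List.map_cons, coboundary_cons]
    rw [ih fun l => f (g x :: l)]

lemma coboundary_coboundary (f : List V → F) (l : List V) :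
    coboundary (coboundary f) l = 0 := by
  induction l generalizing f with
  | nil => simp
  | cons x w ih => simp only [coboundary_cons, coboundary_sub, ih]; ring

/-- The augmentation cochain: `1` on vertices and `0` elsewhere. -/
def augmentation : List V → F
  | [_] => 1
  | _ => 0

lemma coboundary_augmentation (l : List V) :
    coboundary (augmentation : List V → F) l = 0 := by
  match l with
  | [] => simp
  | [x] => simp [coboundary_cons, augmentation]
  | [x, y] => simp [coboundary_cons, augmentation]
  | x :: y :: z :: w =>
    simp [coboundary_cons (F := F), augmentation]
    simpa [augmentation] using coboundary_zero (F := F) w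

/-- A cochain is normalized if it vanishes on lists with two equal consecutive entries. -/
def IsNormalized (f : List V → F) : Prop :=
  ∀ l₁ a l₂, f (l₁ ++ a :: a :: l₂) = 0

lemma IsNormalized.coboundary {f : List V → F} (hf : IsNormalized f) :
    IsNormalized (coboundary f) := by
  intro l₁ a l₂
  induction l₁ generalizing f with
  | nil =>
    have : (fun l => f (a :: a :: l)) = fun _ => 0 := funext fun l => hf [] a l
    simp [coboundary_cons, this, coboundary_zero]
  | cons x w ih =>
    rw [List.cons_append, coboundary_cons, hf w a l₂, ih fun l₁ b l₂ => hf (x :: l₁) b l₂, sub_zero]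

lemma isNormalized_augmentation : IsNormalized (augmentation : List V → F) := by
  intro l₁ a l₂
  match l₁ with
  | [] => rfl
  | [x] => rfl
  | x :: y :: w => rfl

/-! ### Prism and cone operators -/

/-- The dual of the prism operator for the pair of maps `id`, `J`. -/
def prism (J : V → V) : (List V → F) → List V → F
  | _, [] => 0
  | f, x :: w => f (x :: J x :: w.map J) - prism J (fun l => f (x :: l)) w

lemma prism_nil (J : V → V) (f : List V → F) : prism J f [] = 0 := by
  simp [prism]

lemma prism_cons (J : V → V) (f : List V → F) (x : V) (w : List V) :
    prism J f (x :: w) = f (x :: J x :: w.map J) - prism J (fun l => f (x :: l)) w := by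
  simp [prism]

lemma prism_sub (J : V → V) (f g : List V → F) (l : List V) :
    prism J (fun l => f l - g l) l = prism J f l - prism J g l := by
  induction l generalizing f g with
  | nil => simp [prism_nil]
  | cons x w ih => simp only [prism_cons, ih]; ring

lemma prism_coboundary (J : V → V) (f : List V → F) (l : List V) :
    prism J (coboundary f) l + coboundary (prism J f) l = f (l.map J) - f l := by
  induction l generalizing f with
  | nil => simp [prism_nil]
  | cons x w ih =>
    have h := ih fun l => f (x :: l)
    have h1 : coboundary (fun l => f (x :: J x :: l.map J)) w
        = coboundary (fun l => f (x :: J x :: l)) (w.map J) :=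
      coboundary_comp_map J (fun l => f (x :: J x :: l)) w
    simp only [prism_cons, coboundary_cons, prism_sub, coboundary_sub, List.map_cons, h1]
    linear_combination h

lemma prism_eq_zero (J : V → V) (f : List V → F) (l : List V)
    (h : ∀ l₁ x l₂, l = l₁ ++ x :: l₂ → f (l₁ ++ x :: J x :: l₂.map J) = 0) :
    prism J f l = 0 := by
  induction l generalizing f with
  | nil => exact prism_nil J f
  | cons y w ih =>
    rw [prism_cons, ih (fun l => f (y :: l)), sub_zero]
    · exact h [] y w rfl
    · intro l₁ x l₂ hw
      exact h (y :: l₁) x l₂ (by rw [hw]; rfl)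

/-- The dual of the operator that fills a cycle using a homotopy from `id` through `J` to the
constant map `e`. -/
def filling (e : V) (J : V → V) (f : List V → F) (l : List V) : F :=
  f (e :: l.map J) - prism J f l

lemma filling_sub (e : V) (J : V → V) (f g : List V → F) (l : List V) :
    filling e J (fun l => f l - g l) l = filling e J f l - filling e J g l := by
  simp only [filling, prism_sub]; ring

lemma filling_coboundary (e : V) (J : V → V) (f : List V → F) (l : List V) :
    filling e J (coboundary f) l = f l - coboundary (filling e J f) l := by
  have h := prism_coboundary J f l
  have h1 : coboundary (fun l => f (e :: l.map J)) l
      = coboundary (fun l => f (e :: l)) (l.map J) :=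
    coboundary_comp_map J (fun l => f (e :: l)) l
  have h2 : coboundary (filling e J f) l
      = coboundary (fun l => f (e :: l.map J)) l - coboundary (prism J f) l :=
    coboundary_sub _ _ l
  rw [h2, h1, filling, coboundary_cons]
  linear_combination -h

end Cochains

/-! ### Norm and difference of a cyclic action -/

section Cyclic

variable {V W F : Type*} [CommRing F]

/-- The norm operator if `i` is even and the difference operator if `i` is odd, for the action
of `σ` (of order `p`) on cochains. -/
def normDiff (p : ℕ) (σ : V → V) (i : ℕ) (f : List V → F) (l : List V) : F :=
  if Even i then ∑ j ∈ range p, f (l.map σ^[j]) else f (l.map σ) - f l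

lemma normDiff_add_two (p : ℕ) (σ : V → V) (i : ℕ) (f : List V → F) :
    normDiff p σ (i + 2) f = normDiff p σ i f := by
  funext l
  simp [normDiff, Nat.even_add]

lemma normDiff_sub (p : ℕ) (σ : V → V) (i : ℕ) (f g : List V → F) (l : List V) :
    normDiff p σ i (fun l => f l - g l) l = normDiff p σ i f l - normDiff p σ i g l := by
  unfold normDiff
  split_ifs
  · rw [Finset.sum_sub_distrib]
  · ring

lemma normDiff_coboundary (p : ℕ) (σ : V → V) (i : ℕ) (f : List V → F) (l : List V) :
    normDiff p σ i (coboundary f) l = coboundary (normDiff p σ i f) l := by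
  by_cases hi : Even i
  · have : normDiff p σ i f = fun l => ∑ j ∈ range p, f (l.map σ^[j]) := by
      funext l; simp [normDiff, hi]
    rw [this, coboundary_sum]
    simp [normDiff, hi, coboundary_comp_map]
  · have : normDiff p σ i f = fun l => f (l.map σ) - f l := by
      funext l; simp [normDiff, hi]
    rw [this, coboundary_sub, coboundary_comp_map]
    simp [normDiff, hi]

lemma normDiff_comp_map (p : ℕ) {σ : V → V} {τ : W → W} {Φ : V → W}
    (h : ∀ x, Φ (σ x) = τ (Φ x)) (i : ℕ) (f : List W → F) (l : List V) :
    normDiff p σ i (fun l => f (l.map Φ)) l = normDiff p τ i f (l.map Φ) := by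
  have hj : ∀ j, Φ ∘ σ^[j] = τ^[j] ∘ Φ := fun j =>
    funext fun x => (Function.Semiconj.iterate_right (f := Φ) h j) x
  have h1 : Φ ∘ σ = τ ∘ Φ := funext h
  simp only [normDiff, List.map_map, hj, h1]

lemma sum_range_map_iterate_succ {p : ℕ} {σ : V → V} (hσ : σ^[p] = id) (f : List V → F)
    (l : List V) :
    ∑ j ∈ range p, f (l.map σ^[j + 1]) = ∑ j ∈ range p, f (l.map σ^[j]) := by
  have h1 := Finset.sum_range_succ (fun j => f (l.map σ^[j])) p
  have h2 := Finset.sum_range_succ' (fun j => f (l.map σ^[j])) p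
  simp only [hσ, Function.iterate_zero] at h1 h2
  exact add_right_cancel (h2.symm.trans h1)

lemma normDiff_normDiff_succ {p : ℕ} {σ : V → V} (hσ : σ^[p] = id) (i : ℕ) (f : List V → F)
    (l : List V) : normDiff p σ i (normDiff p σ (i + 1) f) l = 0 := by
  have key := sum_range_map_iterate_succ hσ f l
  by_cases hi : Even i
  · have : ¬ Even (i + 1) := by simpa [Nat.even_add_one] using hi
    simp only [normDiff, hi, this, if_true, if_false, List.map_map, ← Function.iterate_succ',
      Finset.sum_sub_distrib]
    rw [key, sub_self]
  · have : Even (i + 1) := by simpa [Nat.even_add_one] using hi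
    simp only [normDiff, hi, this, if_true, if_false, List.map_map, ← Function.iterate_succ]
    rw [key, sub_self]

/-- The value of an equivariant label at the head of a list. -/
def headLabel {A : Type*} [Zero A] (θ : V → A) : List V → A
  | [] => 0
  | x :: _ => θ x

end Cyclic

section Exactness

variable {V : Type*} {p : ℕ} [Fact p.Prime]

lemma headLabel_map_iterate {σ : V → V} {θ : V → ZMod p} (hθ : ∀ x, θ (σ x) = θ x + 1) (j : ℕ)
    (x : V) (w : List V) : headLabel θ ((x :: w).map σ^[j]) = θ x + j := by
  simp only [List.map_cons, headLabel]
  induction j with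
  | zero => simp
  | succ j ih => rw [Function.iterate_succ_apply', hθ, ih]; push_cast; ring

/-- On normalized cochains over `ZMod p` of a free `ZMod p`-set, the kernel of the norm is the
image of the difference and vice versa. -/
lemma exists_normDiff_eq {σ : V → V} {θ : V → ZMod p}
    (hθ : ∀ x, θ (σ x) = θ x + 1) (i : ℕ) {ω : List V → ZMod p} (hn : IsNormalized ω)
    (h0 : ω [] = 0) (hω : ∀ l, normDiff p σ (i + 1) ω l = 0) :
    ∃ ρ : List V → ZMod p, IsNormalized ρ ∧ normDiff p σ i ρ = ω := by
  have hnm : ∀ (g : V → V) l₁ a l₂, ω ((l₁ ++ a :: a :: l₂).map g) = 0 := by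
    intro g l₁ a l₂
    rw [List.map_append]
    exact hn _ _ _
  by_cases hi : Even i
  · have hi' : ¬ Even (i + 1) := by simpa [Nat.even_add_one] using hi
    have hinv : ∀ j l, ω (l.map σ^[j]) = ω l := by
      intro j l
      induction j with
      | zero => simp
      | succ j ih =>
        have := hω (l.map σ^[j])
        simp only [normDiff, hi', if_false, List.map_map, ← Function.iterate_succ'] at this
        rw [← ih]
        exact sub_eq_zero.mp this
    refine ⟨fun l => if headLabel θ l = 0 then ω l else 0, fun l₁ a l₂ => ?_, ?_⟩
    · simp [hn l₁ a l₂]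
    · funext l
      simp only [normDiff, hi, if_true]
      match l with
      | [] => simp [h0]
      | x :: w =>
        simp only [headLabel_map_iterate hθ, hinv]
        rw [Finset.sum_eq_single (-θ x).val]
        · simp
        · intro j hj hne
          rw [if_neg]
          intro h
          apply hne
          have hj' : (j : ZMod p) = -θ x := by linear_combination h
          rw [← hj', ZMod.val_natCast_of_lt (Finset.mem_range.mp hj)]
        · intro h
          exact absurd (Finset.mem_range.mpr (ZMod.val_lt _)) h
  · have hi' : Even (i + 1) := by simpa [Nat.even_add_one] using hi
    refine ⟨fun l => -∑ j ∈ range (-headLabel θ l).val, ω (l.map σ^[j]), fun l₁ a l₂ => ?_, ?_⟩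
    · simp only [hnm, sum_const_zero, neg_zero]
    · funext l
      simp only [normDiff, hi, if_false]
      match l with
      | [] => simp [h0]
      | x :: w =>
        have hh : headLabel θ ((x :: w).map σ) = θ x + 1 := by
          simpa using headLabel_map_iterate hθ 1 x w
        have hh' : headLabel θ (x :: w) = θ x := rfl
        have hsum : ∑ j ∈ range p, ω ((x :: w).map σ^[j]) = 0 := by
          have := hω (x :: w)
          simpa only [normDiff, hi', if_true] using this
        rw [hh, hh']
        simp only [List.map_map, ← Function.iterate_succ]
        obtain ⟨m, hm⟩ : ∃ m, m + 1 = p := ⟨p - 1, Nat.succ_pred (Fact.out : p.Prime).ne_zero⟩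
        by_cases hx : θ x = 0
        · have h1 : (-(θ x + 1)).val = m := by
            have : (-(θ x + 1)) = ((m : ℕ) : ZMod p) := by
              have : ((m + 1 : ℕ) : ZMod p) = 0 := by rw [hm]; simp
              push_cast at this
              rw [hx]; linear_combination -this
            rw [this, ZMod.val_natCast_of_lt (by omega)]
          rw [show range p = range (m + 1) by rw [hm], Finset.sum_range_succ'] at hsum
          rw [h1, hx]
          simp only [Function.iterate_zero, List.map_id, neg_zero, ZMod.val_zero, range_zero,
            sum_empty, sub_zero] at hsum ⊢
          linear_combination -hsum
        · have hpos : (-θ x).val ≠ 0 := by simpa [ZMod.val_eq_zero] using hx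
          obtain ⟨q, hq⟩ := Nat.exists_eq_succ_of_ne_zero hpos
          have h1 : (-(θ x + 1)).val = q := by
            have hlt := ZMod.val_lt (-θ x)
            have : (-(θ x + 1)) = ((q : ℕ) : ZMod p) := by
              have : ((q + 1 : ℕ) : ZMod p) = -θ x := by
                rw [← Nat.succ_eq_add_one, ← hq, ZMod.natCast_zmod_val]
              push_cast at this
              linear_combination -this
            rw [this, ZMod.val_natCast_of_lt (by omega)]
          rw [h1, hq, Nat.succ_eq_add_one, Finset.sum_range_succ' _ q]
          simp only [Function.iterate_zero, List.map_id]
          ring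

end Exactness

/-! ### A Dold-type theorem for relations with a free cyclic action -/

section Dold

variable {P F : Type*} [CommRing F]

/-- Evaluation of cochains on the `i`-th chain of a sequence of chains `h₀, h₁, …` such that
`h₀` is a vertex and `∂ hᵢ₊₁` is the norm or the difference of `hᵢ`. -/
def chainEval (p : ℕ) (σ : P → P) (e : ℕ → P) (J : ℕ → P → P) : ℕ → (List P → F) → F
  | 0, f => f [e 0]
  | i + 1, f => chainEval p σ e J i (normDiff p σ i (filling (e (i + 1)) (J (i + 1)) f))

lemma chainEval_sub (p : ℕ) (σ : P → P) (e : ℕ → P) (J : ℕ → P → P) (i : ℕ)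
    (f g : List P → F) :
    chainEval p σ e J i (fun l => f l - g l)
      = chainEval p σ e J i f - chainEval p σ e J i g := by
  induction i generalizing f g with
  | zero => rfl
  | succ i ih =>
    simp only [chainEval]
    rw [← ih]
    congr 1
    funext l
    rw [← normDiff_sub]
    congr 1
    funext l
    exact filling_sub _ _ f g l

lemma chainEval_coboundary {p : ℕ} [CharP F p] {σ : P → P} (hσ : σ^[p] = id) (e : ℕ → P)
    (J : ℕ → P → P) (i : ℕ) (f : List P → F) :
    chainEval p σ e J (i + 1) (coboundary f) = chainEval p σ e J i (normDiff p σ i f) := by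
  have step : ∀ i (f : List P → F), chainEval p σ e J (i + 1) (coboundary f) = chainEval p σ e J i
      (normDiff p σ i f) - chainEval p σ e J i
        (coboundary (normDiff p σ i (filling (e (i + 1)) (J (i + 1)) f))) := by
    intro i f
    rw [chainEval, ← chainEval_sub]
    congr 1
    funext l
    rw [← normDiff_coboundary, ← normDiff_sub]
    congr 1
    funext l
    exact filling_coboundary _ _ f l
  have key : ∀ i (g : List P → F),
      chainEval p σ e J i (coboundary (normDiff p σ i g)) = 0 := by
    intro i
    induction i with
    | zero => intro g; simp [chainEval, coboundary_cons, normDiff]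
    | succ i ih =>
      intro g
      have h0 : normDiff p σ i (normDiff p σ (i + 1) g) = fun l => (0 : F) - 0 := by
        funext l; rw [normDiff_normDiff_succ hσ, sub_zero]
      rw [step, ih, h0, chainEval_sub, sub_self, sub_zero]
  rw [step, key, sub_zero]

/-- A `ZMod p`-space filtered by subspaces `good 1 ⊆ good 2 ⊆ ⋯ ⊆ good N`, each contractible in
the next one through a homotopy `x ≤ J i x ≥ e i`; the order is only given as a relation. -/
structure ConeFiltration (P : Type*) (p N : ℕ) where
  /-- the order relation -/
  le : P → P → Prop
  /-- the generator of the cyclic action -/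
  σ : P → P
  /-- the levels of the filtration -/
  good : ℕ → P → Prop
  /-- the cone points -/
  e : ℕ → P
  /-- the join with the cone points -/
  J : ℕ → P → P
  iterate_σ : σ^[p] = id
  σ_le : ∀ x y, le x y → le (σ x) (σ y)
  good_σ : ∀ i x, good i x → good i (σ x)
  good_mono : ∀ i x, good i x → good (i + 1) x
  good_e : ∀ i, i < N → good (i + 1) (e i)
  good_J : ∀ i x, good i x → good (i + 1) (J i x)
  le_J : ∀ i x, i < N → good i x → le x (J i x)
  e_le_J : ∀ i x, i < N → le (e i) (J i x)
  J_le : ∀ i x y, le x y → le (J i x) (J i y)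

namespace ConeFiltration

variable {p N : ℕ} (K : ConeFiltration P p N)

lemma normDiff_eq_zero (i m d : ℕ) (f : List P → F)
    (hf : ∀ l, l.IsChain K.le → (∀ x ∈ l, K.good m x) → l.length = d → f l = 0)
    (l : List P) (hl : l.IsChain K.le) (hg : ∀ x ∈ l, K.good m x) (hd : l.length = d) :
    normDiff p K.σ i f l = 0 := by
  have h : ∀ j, f (l.map K.σ^[j]) = 0 := by
    intro j
    have : (l.map K.σ^[j]).IsChain K.le ∧ (∀ x ∈ l.map K.σ^[j], K.good m x)
        ∧ (l.map K.σ^[j]).length = d := by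
      induction j with
      | zero => simpa using ⟨hl, hg, hd⟩
      | succ j ih =>
        rw [Function.iterate_succ', ← List.map_map]
        obtain ⟨h1, h2, h3⟩ := ih
        refine ⟨List.isChain_map_of_isChain _ (fun a b => K.σ_le a b) h1, ?_, by simpa using h3⟩
        intro x hx
        obtain ⟨y, hy, rfl⟩ := List.mem_map.mp hx
        exact K.good_σ m y (h2 y hy)
    exact hf _ this.1 this.2.1 this.2.2
  unfold normDiff
  split_ifs
  · exact Finset.sum_eq_zero fun j _ => h j
  · have h0 := h 0
    have h1 := h 1
    simp only [Function.iterate_zero, Function.iterate_one, List.map_id] at h0 h1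
    rw [h0, h1, sub_zero]

lemma chainEval_eq_zero (i : ℕ) (hi : i < N) (f : List P → F)
    (hf : ∀ l, l.IsChain K.le → (∀ x ∈ l, K.good (i + 1) x) → l.length = i + 1 → f l = 0) :
    chainEval p K.σ K.e K.J i f = 0 := by
  induction i generalizing f with
  | zero => exact hf _ (by simp) (by simpa using K.good_e 0 hi) rfl
  | succ i ih =>
    refine ih (by omega) _ (K.normDiff_eq_zero i (i + 1) (i + 1) _ ?_)
    intro l hl hg hd
    have hmapJ : ∀ w : List P, w.IsChain K.le → (w.map (K.J (i + 1))).IsChain K.le := fun w hw =>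
      List.isChain_map_of_isChain _ (fun a b => K.J_le (i + 1) a b) hw
    have hgJ : ∀ w : List P, (∀ x ∈ w, K.good (i + 1) x) →
        ∀ x ∈ w.map (K.J (i + 1)), K.good (i + 1 + 1) x := by
      intro w hw x hx
      obtain ⟨y, hy, rfl⟩ := List.mem_map.mp hx
      exact K.good_J _ y (hw y hy)
    rw [filling, prism_eq_zero, sub_zero]
    · refine hf _ ?_ ?_ (by simpa using hd)
      · cases l with
        | nil => simp
        | cons x w =>
          rw [List.map_cons, List.isChain_cons_cons]
          exact ⟨K.e_le_J _ _ hi, by simpa using hmapJ _ hl⟩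
      · intro x hx
        rcases List.mem_cons.mp hx with rfl | hx
        · exact K.good_e _ hi
        · exact hgJ l hg x hx
    · rintro l₁ x l₂ rfl
      have hx : K.good (i + 1) x := hg x (by simp)
      refine hf _ ?_ ?_ (by simp at hd ⊢; omega)
      · rw [List.isChain_split] at hl ⊢
        refine ⟨hl.1, ?_⟩
        rw [List.isChain_cons_cons]
        exact ⟨K.le_J _ _ hi hx, by simpa using hmapJ _ hl.2⟩
      · intro y hy
        rw [List.mem_append, List.mem_cons] at hy
        rcases hy with hy | rfl | hy
        · exact K.good_mono _ _ (hg y (by simp [hy]))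
        · exact K.good_mono _ _ hx
        · exact hgJ (x :: l₂) (fun z hz => hg z (by simp at hz ⊢; tauto)) y (by simpa using hy)

/-- An equivariant map to a free `ZMod p`-set that is constant along the relation wherever a
monotone rank with values in `[1, M]` is constant exists only if `N ≤ M`. -/
theorem le_of_equivariant [Fact p.Prime] {Q : Type*} {τ : Q → Q}
    {θ : Q → ZMod p} (hθ : ∀ q, θ (τ q) = θ q + 1) (Φ : P → Q)
    (hΦ : ∀ x, Φ (K.σ x) = τ (Φ x)) (r : P → ℕ) (M : ℕ) (hr : ∀ x, 1 ≤ r x) (hrM : ∀ x, r x ≤ M)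
    (hmono : ∀ x y, K.le x y → r x ≤ r y) (heq : ∀ x y, K.le x y → r x = r y → Φ x = Φ y) :
    N ≤ M := by
  by_contra! hMN
  have key : ∀ i, ∃ ω : List Q → ZMod p, IsNormalized ω ∧ ω [] = 0 ∧
      (∀ l, coboundary ω l = 0) ∧ (∀ l, normDiff p τ (i + 1) ω l = 0) ∧
      chainEval p K.σ K.e K.J i (fun l => ω (l.map Φ)) = 1 := by
    intro i
    induction i with
    | zero =>
      refine ⟨augmentation, isNormalized_augmentation, rfl, coboundary_augmentation, ?_, rfl⟩
      intro l
      match l with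
      | [] => simp [normDiff]
      | [x] => simp [normDiff, augmentation]
      | x :: y :: w => simp [normDiff, augmentation]
    | succ i ih =>
      obtain ⟨ω, hn, h0, hcob, hD, hev⟩ := ih
      obtain ⟨ρ, hρn, hρ⟩ := exists_normDiff_eq hθ i hn h0 hD
      refine ⟨coboundary ρ, hρn.coboundary, coboundary_nil ρ, coboundary_coboundary ρ, ?_, ?_⟩
      · intro l
        rw [normDiff_add_two, normDiff_coboundary, hρ, hcob]
      · have h1 : (fun l : List P => coboundary ρ (l.map Φ))
            = coboundary fun l : List P => ρ (l.map Φ) := by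
          funext l; rw [coboundary_comp_map]
        have h2 : normDiff p K.σ i (fun l : List P => ρ (l.map Φ)) = fun l => ω (l.map Φ) := by
          funext l; rw [normDiff_comp_map p hΦ, hρ]
        rw [h1, chainEval_coboundary K.iterate_σ, h2, hev]
  obtain ⟨ω, hn, -, -, -, hev⟩ := key M
  have hdeg : ∀ l : List P, l.IsChain K.le → l.length ≠ 0 →
      (∃ l₁ x y l₂, l = l₁ ++ x :: y :: l₂ ∧ Φ x = Φ y) ∨
        ∃ x w, l = x :: w ∧ r x + w.length ≤ M := by
    intro l hl h0
    induction l with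
    | nil => simp at h0
    | cons x w ih =>
      cases w with
      | nil => exact Or.inr ⟨x, [], rfl, by simpa using hrM x⟩
      | cons y w =>
        rw [List.isChain_cons_cons] at hl
        rcases ih hl.2 (by simp) with ⟨l₁, a, b, l₂, h, hab⟩ | ⟨a, u, h, hle⟩
        · exact Or.inl ⟨x :: l₁, a, b, l₂, by rw [h]; rfl, hab⟩
        · obtain ⟨rfl, rfl⟩ := List.cons.inj h
          rcases (hmono x y hl.1).eq_or_lt with h | h
          · exact Or.inl ⟨[], x, y, w, rfl, heq x y hl.1 h⟩
          · exact Or.inr ⟨x, y :: w, rfl, by simp; omega⟩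
  refine one_ne_zero (α := ZMod p) (hev.symm.trans (K.chainEval_eq_zero M hMN _ ?_))
  intro l hl _ hlen
  rcases hdeg l hl (by omega) with ⟨l₁, x, y, l₂, rfl, hxy⟩ | ⟨x, w, rfl, hle⟩
  · rw [List.map_append, List.map_cons, List.map_cons, hxy]
    exact hn _ _ _
  · have := hr x
    simp at hlen
    omega

end ConeFiltration

end Dold

/-! ### Signed vectors -/

section SignVectors

variable {p N : ℕ}

/-- Nonzero vectors of length `N` with entries in `ZMod p ∪ {none}`: the faces of the `N`-fold
join of `ZMod p`. -/
abbrev SignVector (p N : ℕ) : Type :=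
  {X : Fin N → Option (ZMod p) // ∃ c, X c ≠ none}

/-- The action of the generator of `ZMod p` on signed vectors. -/
def SignVector.rotate (X : SignVector p N) : SignVector p N :=
  ⟨fun c => (X.1 c).map (· + 1), by obtain ⟨c, hc⟩ := X.2; exact ⟨c, by simpa using hc⟩⟩

lemma SignVector.rotate_iterate (j : ℕ) (X : SignVector p N) (c : Fin N) :
    (SignVector.rotate^[j] X).1 c = (X.1 c).map (· + (j : ZMod p)) := by
  induction j with
  | zero => simp
  | succ j ih =>
    rw [Function.iterate_succ_apply']
    change ((SignVector.rotate^[j] X).1 c).map (· + 1) = _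
    rw [ih, Option.map_map]
    congr 1
    funext a
    simp [add_assoc]

/-- The cone filtration of the signed vectors by their last nonzero coordinate. -/
def signFiltration (p : ℕ) {N : ℕ} (hN : 0 < N) : ConeFiltration (SignVector p N) p N where
  le X Y := ∀ c, X.1 c ≠ none → Y.1 c = X.1 c
  σ := SignVector.rotate
  good i X := ∀ c : Fin N, i ≤ c.val → X.1 c = none
  e i := ⟨fun c => if c.val = i ∨ N ≤ i then some 0 else none, by
    by_cases h : i < N
    · exact ⟨⟨i, h⟩, by simp⟩
    · exact ⟨⟨0, hN⟩, by simp [not_lt.mp h]⟩⟩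
  J i X := ⟨fun c => if c.val = i then some 0 else X.1 c, by
    obtain ⟨c, hc⟩ := X.2
    exact ⟨c, by by_cases h : c.val = i <;> simp [h, hc]⟩⟩
  iterate_σ := by
    funext X
    refine Subtype.ext (funext fun c => ?_)
    rw [SignVector.rotate_iterate]
    simp
  σ_le X Y h c hc := by
    simp only [SignVector.rotate, ne_eq, Option.map_eq_none_iff] at hc ⊢
    rw [h c hc]
  good_σ i X h c hc := by simp [SignVector.rotate, h c hc]
  good_mono i X h c hc := h c (by omega)
  good_e i hi c hc := by
    have : ¬ (c.val = i ∨ N ≤ i) := by omega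
    simp [this]
  good_J i X h c hc := by
    have : ¬ c.val = i := by omega
    simp [this, h c (by omega)]
  le_J i X hi h c hc := by
    have : ¬ c.val = i := fun hci => hc (h c hci.ge)
    simp [this]
  e_le_J i X hi c hc := by
    have : c.val = i := by
      by_contra hci
      exact hc (if_neg (by omega))
    simp [this]
  J_le i X Y h c hc := by
    by_cases hci : c.val = i
    · simp [hci]
    · simp only [hci, if_false] at hc ⊢
      exact h c hc

end SignVectors

section Shift

variable {p : ℕ}

/-- The translate of a set of signs by `1`. -/
def shift (B : Finset (ZMod p)) : Finset (ZMod p) :=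
  B.map (Equiv.addRight (1 : ZMod p)).toEmbedding

lemma mem_shift {B : Finset (ZMod p)} {j : ZMod p} : j ∈ shift B ↔ j - 1 ∈ B := by
  simp [shift, Finset.mem_map_equiv, sub_eq_add_neg]

@[simp] lemma card_shift (B : Finset (ZMod p)) : (shift B).card = B.card := by
  simp [shift]

@[simp] lemma shift_empty : shift (∅ : Finset (ZMod p)) = ∅ := by
  simp [shift]

lemma shift_eq_univ [NeZero p] {B : Finset (ZMod p)} : shift B = univ ↔ B = univ := by
  rw [← Finset.card_eq_iff_eq_univ, card_shift, Finset.card_eq_iff_eq_univ]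

lemma shift_nonempty {B : Finset (ZMod p)} : (shift B).Nonempty ↔ B.Nonempty := by
  rw [← Finset.card_pos, card_shift, Finset.card_pos]

variable [Fact p.Prime]

/-- Translation by `1` increases the mean of a nonempty proper subset of `ZMod p` by `1`. -/
lemma mean_shift {B : Finset (ZMod p)} (hB : B.Nonempty) (hB' : B ≠ univ) :
    (∑ b ∈ shift B, b) / ((shift B).card : ZMod p) = (∑ b ∈ B, b) / (B.card : ZMod p) + 1 := by
  have hlt : B.card < p := by
    simpa [ZMod.card] using (Finset.card_lt_iff_ne_univ B).mpr hB'
  have hne : (B.card : ZMod p) ≠ 0 := by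
    rw [Ne, ZMod.natCast_eq_zero_iff]
    exact fun h => absurd (Nat.le_of_dvd hB.card_pos h) (not_le.mpr hlt)
  rw [card_shift, shift, Finset.sum_map]
  simp only [Equiv.coe_toEmbedding, Equiv.coe_addRight, Finset.sum_add_distrib]
  field_simp
  simp

/-- Families of sets of signs, one of which is nonempty and proper. -/
abbrev FreeFamily (p : ℕ) [Fact p.Prime] (ι : Type*) : Type _ :=
  {q : ι → Finset (ZMod p) // ∃ i, (q i).Nonempty ∧ q i ≠ univ}

/-- Simultaneous translation of a family of sets of signs. -/
def FreeFamily.rotate {ι : Type*} (q : FreeFamily p ι) : FreeFamily p ι :=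
  ⟨fun i => shift (q.1 i), by
    obtain ⟨i, h, h'⟩ := q.2
    exact ⟨i, shift_nonempty.mpr h, fun h => h' (shift_eq_univ.mp h)⟩⟩

lemma FreeFamily.exists_label (p : ℕ) [Fact p.Prime] (ι : Type*) :
    ∃ θ : FreeFamily p ι → ZMod p, ∀ q, θ q.rotate = θ q + 1 := by
  classical
  let θ₀ : Finset (ZMod p) → ZMod p := fun B => (∑ b ∈ B, b) / (B.card : ZMod p)
  refine ⟨fun q => θ₀ (q.1 (Classical.choose q.2)), fun q => ?_⟩
  have hset : (fun i => (q.rotate.1 i).Nonempty ∧ q.rotate.1 i ≠ univ)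
      = fun i => (q.1 i).Nonempty ∧ q.1 i ≠ univ := by
    funext i
    simp only [FreeFamily.rotate, shift_nonempty, Ne, shift_eq_univ]
  have hch : Classical.choose q.rotate.2 = Classical.choose q.2 := by
    congr 1
  obtain ⟨h, h'⟩ := Classical.choose_spec q.2
  simp only [hch]
  exact mean_shift h h'

end Shift

section SignedPartition

variable {p N n : ℕ} [Fact p.Prime] (π : Fin N → Fin n)

/-- The set of signs that a signed vector takes on the fibre over `x`. -/
def signsAt (X : SignVector p N) (x : Fin n) : Finset (ZMod p) :=
  univ.filter fun j => ∃ c, π c = x ∧ X.1 c = some j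

/-- The projection of the set of coordinates of sign `j`. -/
def signSupport (X : SignVector p N) (j : ZMod p) : Finset (Fin n) :=
  univ.filter fun x => j ∈ signsAt π X x

lemma signsAt_rotate (X : SignVector p N) (x : Fin n) :
    signsAt π X.rotate x = shift (signsAt π X x) := by
  ext j
  simp only [mem_shift, signsAt, SignVector.rotate, mem_filter, mem_univ, true_and,
    Option.map_eq_some_iff]
  refine exists_congr fun c => and_congr_right fun _ => ?_
  constructor
  · rintro ⟨a, ha, rfl⟩
    simpa using ha
  · intro h
    exact ⟨_, h, by ring⟩

lemma signSupport_rotate (X : SignVector p N) (j : ZMod p) :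
    signSupport π X.rotate j = signSupport π X (j - 1) := by
  ext x
  simp [signSupport, signsAt_rotate, mem_shift]

lemma card_signsAt_le (X : SignVector p N) (x : Fin n) :
    (signsAt π X x).card ≤ (univ.filter fun c => π c = x).card := by
  classical
  refine (Finset.card_le_card ?_).trans
    (Finset.card_image_le (f := fun c => (X.1 c).getD 0))
  intro j hj
  obtain ⟨c, hc, hj⟩ := (mem_filter.mp hj).2
  exact Finset.mem_image.mpr ⟨c, by simpa using hc, by simp [hj]⟩

lemma signsAt_mono {X Y : SignVector p N} (h : ∀ c, X.1 c ≠ none → Y.1 c = X.1 c) (x : Fin n) :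
    signsAt π X x ⊆ signsAt π Y x := by
  intro j hj
  obtain ⟨c, hc, hj⟩ := (mem_filter.mp hj).2
  exact mem_filter.mpr ⟨mem_univ _, c, hc, by rw [h c (by simp [hj]), hj]⟩

lemma sum_card_signSupport (X : SignVector p N) :
    ∑ j, (signSupport π X j).card = ∑ x, (signsAt π X x).card := by
  simp only [signSupport, Finset.card_filter]
  rw [Finset.sum_comm]
  refine Finset.sum_congr rfl fun x _ => ?_
  rw [← Finset.card_filter]
  congr 1
  ext j
  simp

/-- If two pointwise nested families of finite sets have the same total size, they agree. -/
lemma eq_of_subset_of_sum_card_eq {ι A : Type*} [Fintype ι] {f g : ι → Finset A}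
    (h : ∀ i, f i ⊆ g i) (hc : ∑ i, (f i).card = ∑ i, (g i).card) : f = g := by
  have := (Finset.sum_eq_sum_iff_of_le fun i _ => Finset.card_le_card (h i)).mp hc
  exact funext fun i => Finset.eq_of_subset_of_card_le (h i) (this i (mem_univ i)).ge

/-- A Tucker-type inequality. `U c` is an upward closed family of subsets of `[n]` for every
colour `c`. If no colour class contains all members of an admissible `p`-tuple, and every
admissible `p`-tuple of total size greater than `α` has a member in some colour class, then
`N ≤ α + (p - 1) t`. -/
theorem le_add_mul_of_upwardClosed {α t : ℕ} (U : Fin t → Finset (Fin n) → Prop)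
    (hU : ∀ c A B, A ⊆ B → U c A → U c B)
    (hπ : ∀ x, (univ.filter fun c => π c = x).card < p)
    (hproper : ∀ A : ZMod p → Finset (Fin n),
      (∀ x, (univ.filter fun j => x ∈ A j).card ≤ (univ.filter fun c => π c = x).card) →
      ∀ c, ∃ j, ¬ U c (A j))
    (hlarge : ∀ A : ZMod p → Finset (Fin n),
      (∀ x, (univ.filter fun j => x ∈ A j).card ≤ (univ.filter fun c => π c = x).card) →
      α < ∑ j, (A j).card → ∃ j c, U c (A j)) :
    N ≤ α + (p - 1) * t := by
  classical
  rcases Nat.eq_zero_or_pos N with rfl | hN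
  · exact Nat.zero_le _
  let size : SignVector p N → ℕ := fun X => ∑ x, (signsAt π X x).card
  let colSigns : SignVector p N → Fin t → Finset (ZMod p) := fun X c =>
    univ.filter fun j => U c (signSupport π X j)
  have hadm : ∀ (X : SignVector p N) x, (univ.filter fun j => x ∈ signSupport π X j).card
      ≤ (univ.filter fun c => π c = x).card := by
    intro X x
    refine le_trans (le_of_eq ?_) (card_signsAt_le π X x)
    congr 1
    ext j
    simp [signSupport]
  have hcol_ne : ∀ X c, colSigns X c ≠ univ := by
    intro X c h
    obtain ⟨j, hj⟩ := hproper _ (hadm X) c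
    have : j ∈ colSigns X c := h ▸ mem_univ j
    exact hj (mem_filter.mp this).2
  have hcol_lt : ∀ X c, (colSigns X c).card ≤ p - 1 := by
    intro X c
    have := (Finset.card_lt_iff_ne_univ (colSigns X c)).mpr (hcol_ne X c)
    rw [ZMod.card] at this
    omega
  have hcol_nonempty : ∀ X, α < size X → ∃ c, (colSigns X c).Nonempty := by
    intro X hX
    obtain ⟨j, c, hj⟩ := hlarge _ (hadm X) (by rwa [sum_card_signSupport])
    exact ⟨c, j, mem_filter.mpr ⟨mem_univ _, hj⟩⟩
  have hsigns_ne : ∀ (X : SignVector p N) x, signsAt π X x ≠ univ := by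
    intro X x h
    have h1 := (card_signsAt_le π X x).trans_lt (hπ x)
    rw [h, Finset.card_univ, ZMod.card] at h1
    exact lt_irrefl _ h1
  have hsigns_nonempty : ∀ X : SignVector p N, ∃ x, (signsAt π X x).Nonempty := by
    intro X
    obtain ⟨c, hc⟩ := X.2
    obtain ⟨j, hj⟩ := Option.ne_none_iff_exists'.mp hc
    exact ⟨π c, j, mem_filter.mpr ⟨mem_univ _, c, rfl, hj⟩⟩
  have hsize_pos : ∀ X, 1 ≤ size X := by
    intro X
    obtain ⟨x, hx⟩ := hsigns_nonempty X
    exact hx.card_pos.trans_le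
      (Finset.single_le_sum (f := fun x => (signsAt π X x).card) (fun _ _ => Nat.zero_le _)
        (mem_univ x))
  have hsize_rotate : ∀ X, size X.rotate = size X := by
    intro X
    simp only [size, signsAt_rotate, card_shift]
  have hcol_rotate : ∀ X c, colSigns X.rotate c = shift (colSigns X c) := by
    intro X c
    ext j
    simp only [colSigns, mem_shift, mem_filter, mem_univ, true_and, signSupport_rotate]
  let fam : SignVector p N → Fin n ⊕ Fin t → Finset (ZMod p) := fun X =>
    if size X ≤ α then Sum.elim (signsAt π X) fun _ => ∅ else Sum.elim (fun _ => ∅) (colSigns X)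
  let Φ : SignVector p N → FreeFamily p (Fin n ⊕ Fin t) := fun X => ⟨fam X, by
    by_cases h : size X ≤ α
    · obtain ⟨x, hx⟩ := hsigns_nonempty X
      exact ⟨Sum.inl x, by simpa [fam, h] using ⟨hx, hsigns_ne X x⟩⟩
    · obtain ⟨c, hc⟩ := hcol_nonempty X (not_le.mp h)
      exact ⟨Sum.inr c, by simpa [fam, h] using ⟨hc, hcol_ne X c⟩⟩⟩
  have hΦ : ∀ X, Φ X.rotate = (Φ X).rotate := by
    intro X
    refine Subtype.ext (funext fun i => ?_)
    by_cases h : size X ≤ α <;> rcases i with x | c <;>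
      simp [Φ, fam, FreeFamily.rotate, h, hsize_rotate, signsAt_rotate, hcol_rotate]
  let r : SignVector p N → ℕ := fun X =>
    if size X ≤ α then size X else α + ∑ c, (colSigns X c).card
  have hcol_mono : ∀ X Y : SignVector p N, (∀ c, X.1 c ≠ none → Y.1 c = X.1 c) →
      ∀ c, colSigns X c ⊆ colSigns Y c := by
    intro X Y h c
    refine Finset.monotone_filter_right _ fun j _ hj => hU c _ _ ?_ hj
    exact Finset.monotone_filter_right _ fun x _ hx => signsAt_mono π h x hx
  have hsize_mono : ∀ X Y : SignVector p N, (∀ c, X.1 c ≠ none → Y.1 c = X.1 c) →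
      size X ≤ size Y := fun X Y h =>
    Finset.sum_le_sum fun x _ => Finset.card_le_card (signsAt_mono π h x)
  have hcol_sum_pos : ∀ X, ¬ size X ≤ α → 1 ≤ ∑ c, (colSigns X c).card := by
    intro X hX
    obtain ⟨c, hc⟩ := hcol_nonempty X (not_le.mp hX)
    exact hc.card_pos.trans_le
      (Finset.single_le_sum (f := fun c => (colSigns X c).card) (fun _ _ => Nat.zero_le _)
        (mem_univ c))
  obtain ⟨θ, hθ⟩ := FreeFamily.exists_label p (Fin n ⊕ Fin t)
  refine (signFiltration p hN).le_of_equivariant (τ := FreeFamily.rotate) hθ Φ hΦ r _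
    (fun X => ?_) (fun X => ?_) (fun X Y h => ?_) (fun X Y h hr => ?_)
  · by_cases hX : size X ≤ α
    · simpa [r, hX] using hsize_pos X
    · have := hcol_sum_pos X hX
      simp only [r, hX, if_false]
      omega
  · by_cases hX : size X ≤ α
    · simp only [r, hX, if_true]
      omega
    · simp only [r, hX, if_false]
      refine Nat.add_le_add_left ?_ _
      refine (Finset.sum_le_card_nsmul _ _ _ fun c _ => hcol_lt X c).trans ?_
      simp [mul_comm]
  · have hle := hsize_mono X Y h
    by_cases hY : size Y ≤ α
    · simpa [r, hY, hle.trans hY] using hle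
    · by_cases hX : size X ≤ α
      · simp only [r, hX, hY, if_true, if_false]
        omega
      · simp only [r, hX, hY, if_false]
        exact Nat.add_le_add_left
          (Finset.sum_le_sum fun c _ => Finset.card_le_card (hcol_mono X Y h c)) _
  · have hle := hsize_mono X Y h
    refine Subtype.ext ?_
    by_cases hY : size Y ≤ α
    · have hX := hle.trans hY
      simp only [r, hX, hY, if_true] at hr
      simp only [Φ, fam, hX, hY, if_true]
      rw [eq_of_subset_of_sum_card_eq (signsAt_mono π h) hr]
    · have hYpos := hcol_sum_pos Y hY
      by_cases hX : size X ≤ α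
      · simp only [r, hX, hY, if_true, if_false] at hr
        omega
      · simp only [r, hX, hY, if_false] at hr
        simp only [Φ, fam, hX, hY, if_false]
        rw [eq_of_subset_of_sum_card_eq (hcol_mono X Y h) (Nat.add_left_cancel hr)]

end SignedPartition

/-- A `ZMod p`-indexed family of vertices in which each `x` lies in at most `s x` members is not
monochromatic. -/
lemma IsProperColoring.exists_ne {n k p t : ℕ} [Fact p.Prime] {s : Fin n → ℕ}
    {col : KGSVertex n k → Fin t} (hcol : IsProperColoring (KGSEdges n k p s) col)
    (v : ZMod p → KGSVertex n k)
    (hv : ∀ x, (univ.filter fun j => x ∈ (v j).1).card ≤ s x) (c : Fin t) :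
    ∃ j, col (v j) ≠ c := by
  by_contra! h
  have hedge : (univ : Finset (ZMod p)).val.map v ∈ KGSEdges n k p s := by
    refine ⟨by simp, fun x => ?_⟩
    rw [Multiset.filter_map, Multiset.card_map]
    exact hv x
  obtain ⟨a, ha, b, hb, hab⟩ := hcol _ hedge
  obtain ⟨i, -, rfl⟩ := Multiset.mem_map.mp ha
  obtain ⟨j, -, rfl⟩ := Multiset.mem_map.mp hb
  exact hab ((h i).trans (h j).symm)

lemma IsProperColoring.sum_le {n k p t : ℕ} {s : Fin n → ℕ} (hp : p.Prime) (hk : 1 ≤ k)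
    (hs : ∀ i, s i ≤ p) {col : KGSVertex n k → Fin t}
    (hcol : IsProperColoring (KGSEdges n k p s) col) :
    ∑ i, s i ≤ p * (k - 1) + (p - 1) * t := by
  classical
  have : Fact p.Prime := ⟨hp⟩
  set T : Finset (Fin n) := univ.filter fun x => s x = p with hT
  let s' : Fin n → ℕ := fun x => if s x = p then 0 else s x
  have hsum : ∑ i, s i = ∑ i, s' i + p * T.card := by
    have : ∀ i, s i = s' i + if s i = p then p else 0 := by
      intro i
      simp only [s']
      split_ifs with h <;> simp [h]
    rw [Finset.sum_congr rfl fun i _ => this i, Finset.sum_add_distrib, ← Finset.sum_filter]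
    simp [hT, mul_comm]
  have hTk : T.card < k := by
    by_contra! h
    obtain ⟨A, hA, hAk⟩ := Finset.exists_subset_card_eq h
    suffices hv : ∀ x, (univ.filter fun _ : ZMod p => x ∈ A).card ≤ s x by
      obtain ⟨j, hj⟩ := hcol.exists_ne (fun _ => ⟨A, hAk⟩) hv (col ⟨A, hAk⟩)
      exact hj rfl
    intro x
    by_cases hx : x ∈ A
    · have : s x = p := (mem_filter.mp (hA hx)).2
      simp [hx, this]
    · simp [hx]
  let E : Fin (∑ i, s' i) ≃ Σ x, Fin (s' x) :=
    (Fintype.equivFinOfCardEq (by simp)).symm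
  let π : Fin (∑ i, s' i) → Fin n := fun c => (E c).1
  have hfib : ∀ x, (univ.filter fun c => π c = x).card = s' x := by
    intro x
    rw [← Fintype.card_subtype]
    have e1 : {c // π c = x} ≃ {y : Σ x, Fin (s' x) // y.1 = x} :=
      E.subtypeEquiv fun c => Iff.rfl
    rw [Fintype.card_congr (e1.trans (Equiv.sigmaSubtype x)), Fintype.card_fin]
  have hs'T : ∀ x ∈ T, s' x = 0 := fun x hx => if_pos (mem_filter.mp hx).2
  have hs'_notT : ∀ x, x ∉ T → s' x = s x := fun x hx =>
    if_neg fun h => hx (mem_filter.mpr ⟨mem_univ _, h⟩)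
  let U : Fin t → Finset (Fin n) → Prop := fun c A =>
    ∃ v : KGSVertex n k, col v = c ∧ v.1 ⊆ A ∪ T
  have key := le_add_mul_of_upwardClosed (p := p) π (α := p * (k - 1 - T.card)) U ?_ ?_ ?_ ?_
  · have h1 : p * (k - 1) = p * (k - 1 - T.card) + p * T.card := by
      rw [← mul_add]
      congr 1
      omega
    omega
  · rintro c A B hAB ⟨v, hv, hvA⟩
    exact ⟨v, hv, hvA.trans (Finset.union_subset_union_left hAB)⟩
  · intro x
    rw [hfib]
    by_cases hx : x ∈ T
    · rw [hs'T x hx]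
      exact hp.pos
    · rw [hs'_notT x hx]
      exact lt_of_le_of_ne (hs x) fun h => hx (mem_filter.mpr ⟨mem_univ _, h⟩)
  · intro A hA c
    by_contra! h
    choose v hv hvA using h
    suffices hvs : ∀ x, (univ.filter fun j => x ∈ (v j).1).card ≤ s x by
      obtain ⟨j, hj⟩ := hcol.exists_ne v hvs c
      exact hj (hv j)
    intro x
    by_cases hx : x ∈ T
    · rw [(mem_filter.mp hx).2]
      exact (Finset.card_le_univ _).trans_eq (ZMod.card p)
    · rw [← hs'_notT x hx, ← hfib x]
      refine le_trans (Finset.card_le_card ?_) (hA x)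
      refine Finset.monotone_filter_right _ fun j _ hj => ?_
      exact (Finset.mem_union.mp (hvA j hj)).resolve_right hx
  · intro A hA hlt
    obtain ⟨j, -, hj⟩ : ∃ j ∈ (univ : Finset (ZMod p)), k - 1 - T.card < (A j).card := by
      refine Finset.exists_lt_of_sum_lt ?_
      simpa [ZMod.card] using hlt
    have hdisj : Disjoint (A j) T := by
      rw [Finset.disjoint_left]
      intro x hx hxT
      have h0 := hA x
      rw [hfib, hs'T x hxT, Nat.le_zero, Finset.card_eq_zero] at h0
      exact Finset.notMem_empty j (h0 ▸ mem_filter.mpr ⟨mem_univ _, hx⟩)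
    obtain ⟨B, hB, hBk⟩ : ∃ B ⊆ A j ∪ T, B.card = k := by
      refine Finset.exists_subset_card_eq ?_
      rw [Finset.card_union_of_disjoint hdisj]
      omega
    exact ⟨j, col ⟨B, hBk⟩, ⟨B, hBk⟩, rfl, hB⟩

/-- Corollary (Ziegler's claim for prime `r`): for a prime `p`, `0 ≤ s_i ≤ p` and
`n̄ = ∑ s_i ≥ pk`, the chromatic number of `KG^p_S(n,k)` is at least
`⌈(n̄ - p(k-1))/(p-1)⌉`; this follows from the `(n̄ - pk - 1)`-connectivity of
`C_s(n,k,…,k)` together with the Alon–Frankl–Lovász bound. -/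
theorem chromatic_KGS_ge_prime (n k p : ℕ) (s : Fin n → ℕ)
    (hp : p.Prime) (hk : 1 ≤ k) (hs : ∀ i, s i ≤ p) (hsum : p * k ≤ ∑ i, s i) :
    (((∑ i, s i) - p * (k - 1)) ⌈/⌉ (p - 1) : ℕ) ≤ hypChromatic (KGSEdges n k p s) := by
  refine le_sInf ?_
  rintro _ ⟨t, rfl, col, hcol⟩
  have h := hcol.sum_le hp hk hs
  have hp1 : 0 < p - 1 := Nat.sub_pos_of_lt hp.one_lt
  refine Nat.cast_le.mpr ((ceilDiv_le_iff_le_mul hp1).mpr ?_)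
  omega
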